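/- Let F be a field and let μ = (1^{h−1}, n−h+1) be a hook partition of n with h parts. Then the images of the Demazure atoms π̄_w(x_{D(w)}), for those w ∈ 𝔖_n with D(w) ⊆ {1,…,h−1}, form an F-vector-space basis of R_μ = F[x_1,…,x_n]/I_μ. (Basis assertion in the proof of Theorem 8.2.) -/

import Mathlib

open MvPolynomial

/-- Value of a permutation of `Fin n` as a function `ℕ → ℕ` (0 outside range). -/
def pval {n : ℕ} (w : Equiv.Perm (Fin n)) (i : ℕ) : ℕ :=
  if h : i < n then (w ⟨i, h⟩ : ℕ) else 0

/-- 0-based descent set of `w`: `i ∈ permDes w` iff `w(i) > w(i+1)`, `0 ≤ i ≤ n-2`.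
(This corresponds to the 1-based descent `i+1` of the paper.) -/
def permDes {n : ℕ} (w : Equiv.Perm (Fin n)) : Finset ℕ :=
  (Finset.range (n - 1)).filter fun i => pval w (i + 1) < pval w i

/-- Number of inversions = Coxeter length of `w`. -/
def invNum {n : ℕ} (w : Equiv.Perm (Fin n)) : ℕ :=
  (Finset.univ.filter fun p : Fin n × Fin n => p.1 < p.2 ∧ w p.2 < w p.1).card

/-- The simple transposition `s_i = (i, i+1)` (0-based); identity if out of range. -/
def sw (n : ℕ) (i : ℕ) : Equiv.Perm (Fin n) :=
  if h : i + 1 < n then Equiv.swap ⟨i, Nat.lt_of_succ_lt h⟩ ⟨i + 1, h⟩ else 1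

/-- Exponent vector of `x_I = ∏_{i ∈ I} (x_0 x_1 ⋯ x_i)`. -/
def expI (n : ℕ) (I : Finset ℕ) : Fin n → ℕ := fun j => (I.filter fun i => (j : ℕ) ≤ i).card

/-- The monomial `x_I = ∏_{i ∈ I} (x_0 x_1 ⋯ x_i)`. -/
noncomputable def xI (R : Type*) [CommRing R] (n : ℕ) (I : Finset ℕ) :
    MvPolynomial (Fin n) R :=
  ∏ j : Fin n, (X j) ^ expI n I j

/-- `λ(d)`: the decreasing rearrangement of an exponent vector. -/
def lam {n : ℕ} (d : Fin n → ℕ) : List ℕ := (List.ofFn d).insertionSort (· ≥ ·)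

/-- `x^d ≺ x^e` : `λ(d)` lexicographically smaller than `λ(e)`. -/
def monLT {n : ℕ} (d e : Fin n → ℕ) : Prop := List.Lex (· < ·) (lam d) (lam e)

/-- 0-based descent set `D(α)` of a composition `α` of `n`:
`{α_1 + ⋯ + α_j - 1 : 1 ≤ j ≤ ℓ(α) - 1}` (0-based shift of the paper's `D(α)`). -/
def compDes {n : ℕ} (c : Composition n) : Finset ℕ :=
  (Finset.range (c.length - 1)).image fun j => c.sizeUpTo (j + 1) - 1

/-- `d_k(μ) = μ′_1 + ⋯ + μ′_k`, where `μ′` is the conjugate partition of `μ`, written with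
`n` parts `μ′_1 ≤ ⋯ ≤ μ′_n` (allowing zeros), so that `μ′_j = #{parts of μ ≥ n+1-j}`. -/
def dk (n : ℕ) (μ : n.Partition) (k : ℕ) : ℕ :=
  ∑ i ∈ Finset.Icc (n + 1 - k) n, (μ.parts.filter fun p => i ≤ p).card

/-- The elementary symmetric polynomial `e_r(S)` in the set `S` of variables. -/
noncomputable def esymmS (F : Type*) [Field F] {n : ℕ} (S : Finset (Fin n)) (r : ℕ) :
    MvPolynomial (Fin n) F :=
  ∑ T ∈ S.powersetCard r, ∏ x ∈ T, X x

/-- The Tanisaki ideal `I_μ`, generated by the `e_r(S)` with `|S| = k` and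
`k ≥ r > k - d_k(μ)`. -/
noncomputable def tanisaki (n : ℕ) (F : Type*) [Field F] (μ : n.Partition) :
    Ideal (MvPolynomial (Fin n) F) :=
  Ideal.span {f : MvPolynomial (Fin n) F | ∃ (k r : ℕ) (S : Finset (Fin n)),
    S.card = k ∧ r ≤ k ∧ k - dk n μ k < r ∧ f = esymmS F S r}

/-- A partition is a hook if at most one part exceeds `1`. -/
def IsHook {n : ℕ} (μ : n.Partition) : Prop :=
  (μ.parts.filter fun p => 2 ≤ p).card ≤ 1

section RefKey

variable {n : ℕ}

/-- The lexicographically largest rearrangement of `f`. -/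
noncomputable def lexMax (f : Fin n → ℕ) : Lex (Fin n → ℕ) :=
  Finset.univ.sup' Finset.univ_nonempty fun σ : Equiv.Perm (Fin n) => toLex (f ∘ σ)

/-- The rearrangement of `f` by `σ`, tagged by `σ` in such a way that lexicographically smaller
permutations come out larger. -/
def permKey (f : Fin n → ℕ) (σ : Equiv.Perm (Fin n)) :
    Lex (Fin n → ℕ) ×ₗ Lex (Fin n → ℕ) :=
  toLex (toLex (f ∘ σ), toLex fun i => n - (σ i : ℕ))

/-- A total refinement of the order by decreasing rearrangements: ties are broken by the
permutation which sorts `f` stably. -/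
noncomputable def refKey (f : Fin n → ℕ) : Lex (Fin n → ℕ) ×ₗ Lex (Fin n → ℕ) :=
  Finset.univ.sup' Finset.univ_nonempty (permKey f)

theorem le_lexMax (f : Fin n → ℕ) (σ : Equiv.Perm (Fin n)) : toLex (f ∘ σ) ≤ lexMax f :=
  Finset.le_sup' (fun σ : Equiv.Perm (Fin n) => toLex (f ∘ σ)) (Finset.mem_univ σ)

theorem exists_lexMax_eq (f : Fin n → ℕ) :
    ∃ σ : Equiv.Perm (Fin n), lexMax f = toLex (f ∘ σ) := by
  obtain ⟨σ, -, h⟩ := Finset.exists_mem_eq_sup' Finset.univ_nonempty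
    fun σ : Equiv.Perm (Fin n) => toLex (f ∘ σ)
  exact ⟨σ, h⟩

theorem permKey_le_refKey (f : Fin n → ℕ) (σ : Equiv.Perm (Fin n)) : permKey f σ ≤ refKey f :=
  Finset.le_sup' (permKey f) (Finset.mem_univ σ)

theorem exists_refKey_eq (f : Fin n → ℕ) :
    ∃ σ : Equiv.Perm (Fin n), refKey f = permKey f σ := by
  obtain ⟨σ, -, h⟩ := Finset.exists_mem_eq_sup' Finset.univ_nonempty (permKey f)
  exact ⟨σ, h⟩

theorem refKey_injective : Function.Injective (refKey (n := n)) := by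
  intro f g hfg
  obtain ⟨σ, hσ⟩ := exists_refKey_eq f
  obtain ⟨τ, hτ⟩ := exists_refKey_eq g
  have h : permKey f σ = permKey g τ := by rw [← hσ, ← hτ, hfg]
  simp only [permKey, EmbeddingLike.apply_eq_iff_eq, Prod.mk.injEq] at h
  have hστ : σ = τ := by
    ext i
    have := congrFun h.2 i
    have h1 := (σ i).isLt
    have h2 := (τ i).isLt

    omega
  subst hστ
  funext i
  simpa using congrFun h.1 (σ.symm i)

theorem lexMax_comp_le (f : Fin n → ℕ) (τ : Equiv.Perm (Fin n)) :
    lexMax (f ∘ τ) ≤ lexMax f := by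
  obtain ⟨σ, hσ⟩ := exists_lexMax_eq (f ∘ τ)
  rw [hσ]
  exact le_lexMax f (τ * σ)

theorem lexMax_comp (f : Fin n → ℕ) (τ : Equiv.Perm (Fin n)) :
    lexMax (f ∘ τ) = lexMax f := by
  refine le_antisymm (lexMax_comp_le f τ) ?_
  have h := lexMax_comp_le (f ∘ τ) τ⁻¹
  have h2 : (f ∘ τ) ∘ (τ⁻¹ : Equiv.Perm (Fin n)) = f := by funext i; simp
  rwa [h2] at h

theorem lexMax_add_le (f g : Fin n → ℕ) : lexMax (f + g) ≤ lexMax f + lexMax g := by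
  obtain ⟨σ, hσ⟩ := exists_lexMax_eq (f + g)
  rw [hσ]
  exact add_le_add (le_lexMax f σ) (le_lexMax g σ)

theorem lexMax_eq_of_antitone {f : Fin n → ℕ} {w : Equiv.Perm (Fin n)}
    (hw : Antitone (f ∘ w)) : lexMax f = toLex (f ∘ w) := by
  obtain ⟨σ, hσ⟩ := exists_lexMax_eq f
  have hσa : Antitone (f ∘ σ) := by
    intro i j hij
    by_contra! hlt
    have h1 : toLex (f ∘ σ) < toLex (f ∘ (σ * Equiv.swap i j : Equiv.Perm (Fin n))) := by
      have hij' : i < j := lt_of_le_of_ne hij (by rintro rfl; exact lt_irrefl _ hlt)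
      refine ⟨i, fun k hk => ?_, ?_⟩
      · simp [Equiv.swap_apply_of_ne_of_ne hk.ne (hk.trans hij').ne]
      · simpa using hlt
    exact absurd (le_lexMax f (σ * Equiv.swap i j)) (by rw [hσ]; exact not_le.mpr h1)
  rw [hσ, Tuple.unique_antitone hσa hw]

theorem refKey_eq_permKey {f : Fin n → ℕ} {w : Equiv.Perm (Fin n)} (hw : Antitone (f ∘ w))
    (ht : ∀ i j, i < j → f (w i) = f (w j) → w i < w j) : refKey f = permKey f w := by
  refine le_antisymm ?_ (permKey_le_refKey f w)
  obtain ⟨σ, hσ⟩ := exists_refKey_eq f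
  rw [hσ, permKey, permKey, Prod.Lex.toLex_le_toLex]
  have h1 : toLex (f ∘ σ) ≤ toLex (f ∘ w) := lexMax_eq_of_antitone hw ▸ le_lexMax f σ
  rcases h1.lt_or_eq with h1 | h1
  · exact Or.inl h1
  refine Or.inr ⟨h1, ?_⟩
  by_contra! hlt
  obtain ⟨i, hi, hlt⟩ := hlt
  have hi' : ∀ j < i, w j = σ j := by
    intro j hj
    have := hi j hj
    have h2 := (σ j).isLt
    have h3 := (w j).isLt
    apply Fin.ext
    simp only [Pi.toLex_apply] at this
    omega
  have hlt' : σ i < w i := by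
    simp only [Pi.toLex_apply] at hlt
    rw [Fin.lt_def]
    omega
  obtain ⟨j, hj⟩ := w.surjective (σ i)
  have hij : i < j := by
    rcases lt_trichotomy i j with h | h | h
    · exact h
    · subst h; rw [hj] at hlt'; exact absurd hlt' (lt_irrefl _)
    · have := hi' j h
      rw [hj] at this
      exact absurd (σ.injective this) h.ne'
  have hfi : f (w i) = f (w j) := by
    rw [hj]
    exact (congrFun (toLex.injective h1) i).symm
  have := ht i j hij hfi
  rw [hj] at this
  exact lt_asymm this hlt'

theorem refKey_lt_permKey_of_lexMax_lt {f g : Fin n → ℕ} {w : Equiv.Perm (Fin n)}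
    (h : lexMax f < toLex (g ∘ w)) : refKey f < permKey g w := by
  obtain ⟨σ, hσ⟩ := exists_refKey_eq f
  rw [hσ, permKey, permKey, Prod.Lex.toLex_lt_toLex]
  exact Or.inl ((le_lexMax f σ).trans_lt h)

theorem lexMax_le_of_refKey_le {f g : Fin n → ℕ} {w : Equiv.Perm (Fin n)}
    (h : refKey f ≤ permKey g w) : lexMax f ≤ toLex (g ∘ w) := by
  obtain ⟨σ, hσ⟩ := exists_lexMax_eq f
  have := (permKey_le_refKey f σ).trans h
  rw [permKey, permKey, Prod.Lex.toLex_le_toLex] at this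
  rw [hσ]
  rcases this with h | h
  · exact h.le
  · exact h.1.le

theorem refKey_add_le {f g f₀ g₀ : Fin n → ℕ} {w : Equiv.Perm (Fin n)}
    (hf : refKey f ≤ permKey f₀ w) (hg : lexMax g ≤ toLex (g₀ ∘ w)) :
    refKey (f + g) ≤ permKey (f₀ + g₀) w := by
  obtain ⟨σ, hσ⟩ := exists_refKey_eq (f + g)
  have h1 := (permKey_le_refKey f σ).trans hf
  have h2 := (le_lexMax g σ).trans hg
  rw [hσ]
  rw [permKey, permKey, Prod.Lex.toLex_le_toLex] at h1 ⊢
  have e1 : toLex ((f + g) ∘ σ) = toLex (f ∘ σ) + toLex (g ∘ σ) := rfl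
  have e2 : toLex ((f₀ + g₀) ∘ w) = toLex (f₀ ∘ w) + toLex (g₀ ∘ w) := rfl
  simp only [e1, e2] at h1 ⊢
  rcases h1 with h1 | ⟨h1, h3⟩
  · exact Or.inl (add_lt_add_of_lt_of_le h1 h2)
  · rcases h2.lt_or_eq with h2 | h2
    · exact Or.inl (add_lt_add_of_le_of_lt h1.le h2)
    · exact Or.inr ⟨by rw [h1, h2], h3⟩

/-- Moving two entries of `f` strictly inwards lowers the decreasing rearrangement. -/
theorem lexMax_update_lt {f : Fin n → ℕ} {i j : Fin n} (hij : i ≠ j) {p q : ℕ}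
    (hp : p < f i) (hq : q < f i) :
    lexMax (Function.update (Function.update f i p) j q) < lexMax f := by
  obtain ⟨σ, hσ⟩ := exists_lexMax_eq (Function.update (Function.update f i p) j q)
  rw [hσ]
  rcases lt_or_gt_of_ne (σ.symm.injective.ne hij) with h | h
  · refine lt_of_lt_of_le ⟨σ.symm i, fun k hk => ?_, ?_⟩ (le_lexMax f σ)
    · have h1 : σ k ≠ i := by rintro rfl; simp at hk
      have h2 : σ k ≠ j := by rintro rfl; simpa using hk.trans h
      simp [h1, h2]
    · simp [hij, hp]
  · refine lt_of_lt_of_le ⟨σ.symm j, fun k hk => ?_, ?_⟩ (le_lexMax f (Equiv.swap i j * σ))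
    · have h1 : σ k ≠ j := by rintro rfl; simp at hk
      have h2 : σ k ≠ i := by rintro rfl; simpa using hk.trans h
      simp [h1, h2, Equiv.swap_apply_of_ne_of_ne]
    · simp [hq]

end RefKey

section Atom

variable {n : ℕ} {F : Type*} [Field F]

/-- `δ` is the Demazure atom operator `π̄` for the pair of variables `X i`, `X j`. -/
def IsAtomOp (i j : Fin n) (δ : MvPolynomial (Fin n) F →ₗ[F] MvPolynomial (Fin n) F) : Prop :=
  ∀ f, (X i - X j) * δ f = X j * (f - rename (Equiv.swap i j) f)

theorem X_sub_X_ne_zero {i j : Fin n} (hij : i ≠ j) :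
    (X i - X j : MvPolynomial (Fin n) F) ≠ 0 :=
  sub_ne_zero.mpr fun h => hij (X_injective h)

theorem exists_isAtomOp {i j : Fin n} (hij : i ≠ j)
    {D : MvPolynomial (Fin n) F → MvPolynomial (Fin n) F}
    (hD : ∀ f, (X i - X j) * D f = X i * f - X j * rename (Equiv.swap i j) f) :
    ∃ δ : MvPolynomial (Fin n) F →ₗ[F] MvPolynomial (Fin n) F,
      IsAtomOp i j δ ∧ ∀ f, δ f = D f - f := by
  refine ⟨{ toFun := fun f => D f - f, map_add' := fun f g => ?_, map_smul' := fun c f => ?_ },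
    fun f => ?_, fun f => rfl⟩
  · apply mul_left_cancel₀ (X_sub_X_ne_zero (F := F) hij)
    have h1 := hD f
    have h2 := hD g
    have h3 := hD (f + g)
    rw [map_add] at h3
    linear_combination h3 - h1 - h2
  · apply mul_left_cancel₀ (X_sub_X_ne_zero (F := F) hij)
    have h1 := hD f
    have h3 := hD (c • f)
    rw [map_smul] at h3
    simp only [smul_eq_C_mul, RingHom.id_apply] at h3 ⊢
    linear_combination h3 - C c * h1
  · have h1 := hD f
    simp only [LinearMap.coe_mk, AddHom.coe_mk]
    linear_combination h1

/-- The exponent vector `d` with its entries at `i` and `j` replaced by `p` and `q`. -/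
noncomputable def upd₂ (d : Fin n →₀ ℕ) (i j : Fin n) (p q : ℕ) : Fin n →₀ ℕ :=
  (d.update i p).update j q

theorem coe_upd₂ (d : Fin n →₀ ℕ) (i j : Fin n) (p q : ℕ) :
    ⇑(upd₂ d i j p q) = Function.update (Function.update d i p) j q := by
  rw [upd₂, Finsupp.coe_update, Finsupp.coe_update]

theorem mapDomain_perm_apply (d : Fin n →₀ ℕ) (σ : Equiv.Perm (Fin n)) (x : Fin n) :
    d.mapDomain σ x = d (σ⁻¹ x) := by
  rw [← Finsupp.equivMapDomain_eq_mapDomain]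
  rfl

theorem upd₂_swap {i j : Fin n} (hij : i ≠ j) (d : Fin n →₀ ℕ) :
    upd₂ d i j (d j) (d i) = d.mapDomain (Equiv.swap i j) := by
  ext x
  rw [coe_upd₂, mapDomain_perm_apply, Equiv.swap_inv]
  rcases eq_or_ne x j with rfl | hj
  · simp
  rcases eq_or_ne x i with rfl | hi
  · simp [hij]
  · simp [hi, hj, Equiv.swap_apply_of_ne_of_ne]

theorem upd₂_self (i j : Fin n) (d : Fin n →₀ ℕ) :
    upd₂ d i j (d i) (d j) = d := by
  ext x
  simp [coe_upd₂]

theorem X_mul_monomial_upd₂_left {i j : Fin n} (hij : i ≠ j) (d : Fin n →₀ ℕ) (p q : ℕ) :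
    (X i : MvPolynomial (Fin n) F) * monomial (upd₂ d i j p q) 1
      = monomial (upd₂ d i j (p + 1) q) 1 := by
  rw [X, monomial_mul, one_mul]
  refine congrArg (fun e => monomial e (1 : F)) (Finsupp.ext fun x => ?_)
  rw [Finsupp.add_apply, coe_upd₂, coe_upd₂]
  rcases eq_or_ne x j with rfl | hj
  · simp [hij]
  rcases eq_or_ne x i with rfl | hi
  · simp [hij]; omega
  · simp [hi, hj]

theorem X_mul_monomial_upd₂_right {i j : Fin n} (d : Fin n →₀ ℕ) (p q : ℕ) :
    (X j : MvPolynomial (Fin n) F) * monomial (upd₂ d i j p q) 1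
      = monomial (upd₂ d i j p (q + 1)) 1 := by
  rw [X, monomial_mul, one_mul]
  refine congrArg (fun e => monomial e (1 : F)) (Finsupp.ext fun x => ?_)
  rw [Finsupp.add_apply, coe_upd₂, coe_upd₂]
  rcases eq_or_ne x j with rfl | hj
  · simp; omega
  · simp [hj]

theorem IsAtomOp.monomial_of_le {i j : Fin n} (hij : i ≠ j)
    {δ : MvPolynomial (Fin n) F →ₗ[F] MvPolynomial (Fin n) F} (hδ : IsAtomOp i j δ)
    {d : Fin n →₀ ℕ} (hd : d j ≤ d i) :
    δ (monomial d 1)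
      = ∑ t ∈ Finset.range (d i - d j), monomial (upd₂ d i j (d j + t) (d i - t)) 1 := by
  apply mul_left_cancel₀ (X_sub_X_ne_zero (F := F) hij)
  rw [hδ, rename_monomial, Finset.mul_sum]
  let m : ℕ → MvPolynomial (Fin n) F :=
    fun t => monomial (upd₂ d i j (d j + t) (d i - t + 1)) 1
  have h : ∀ t ∈ Finset.range (d i - d j),
      (X i - X j : MvPolynomial (Fin n) F) * monomial (upd₂ d i j (d j + t) (d i - t)) 1
        = m (t + 1) - m t := by
    intro t ht
    rw [Finset.mem_range] at ht
    rw [sub_mul, X_mul_monomial_upd₂_left hij, X_mul_monomial_upd₂_right]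
    have : d i - (t + 1) + 1 = d i - t := by omega
    simp only [m, this, add_assoc]
  rw [Finset.sum_congr rfl h, Finset.sum_range_sub]
  have e1 : d j + (d i - d j) = d i := by omega
  have e2 : d i - (d i - d j) = d j := by omega
  simp only [m, e1, e2, add_zero, tsub_zero]
  rw [← X_mul_monomial_upd₂_right, ← X_mul_monomial_upd₂_right, upd₂_swap hij, upd₂_self]
  ring

theorem IsAtomOp.rename_swap {i j : Fin n} (hij : i ≠ j)
    {δ : MvPolynomial (Fin n) F →ₗ[F] MvPolynomial (Fin n) F} (hδ : IsAtomOp i j δ)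
    (f : MvPolynomial (Fin n) F) : δ (rename (Equiv.swap i j) f) = - δ f := by
  apply mul_left_cancel₀ (X_sub_X_ne_zero (F := F) hij)
  have h1 := hδ f
  have h2 := hδ (rename (Equiv.swap i j) f)
  rw [rename_rename] at h2
  have : ((Equiv.swap i j : Fin n → Fin n) ∘ Equiv.swap i j) = id := by
    funext x; simp
  rw [this, rename_id_apply] at h2
  linear_combination h1 + h2

/-- A linear map sends polynomials with exponents in `A` to such polynomials as soon as it does
so for monomials. -/
theorem map_mem_restrictSupport {A : Set (Fin n →₀ ℕ)}
    {δ : MvPolynomial (Fin n) F →ₗ[F] MvPolynomial (Fin n) F}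
    (h : ∀ d ∈ A, δ (monomial d 1) ∈ restrictSupport F A) {f : MvPolynomial (Fin n) F}
    (hf : f ∈ restrictSupport F A) : δ f ∈ restrictSupport F A := by
  rw [restrictSupport_eq_span] at hf
  have : Submodule.span F ((fun d => monomial d (1 : F)) '' A)
      ≤ (restrictSupport F A).comap δ := by
    rw [Submodule.span_le]
    rintro _ ⟨d, hd, rfl⟩
    exact h d hd
  exact this hf

/-- The sets of exponents stable under replacing two entries by a pair lying between them, at
least one of which is nonzero. -/
theorem IsAtomOp.mem_restrictSupport {i j : Fin n} (hij : i ≠ j)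
    {δ : MvPolynomial (Fin n) F →ₗ[F] MvPolynomial (Fin n) F} (hδ : IsAtomOp i j δ)
    {A : Set (Fin n →₀ ℕ)} (hA₁ : ∀ d ∈ A, d.mapDomain (Equiv.swap i j) ∈ A)
    (hA₂ : ∀ d ∈ A, d j ≤ d i → ∀ t < d i - d j, upd₂ d i j (d j + t) (d i - t) ∈ A)
    {f : MvPolynomial (Fin n) F} (hf : f ∈ restrictSupport F A) :
    δ f ∈ restrictSupport F A := by
  refine map_mem_restrictSupport ?_ hf
  have key : ∀ d ∈ A, d j ≤ d i → δ (monomial d 1) ∈ restrictSupport F A := by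
    intro d hd hle
    rw [hδ.monomial_of_le hij hle]
    refine Submodule.sum_mem _ fun t ht => ?_
    rw [monomial_mem_restrictSupport]
    exact Or.inl (hA₂ d hd hle t (Finset.mem_range.mp ht))
  intro d hd
  rcases le_total (d j) (d i) with hle | hle
  · exact key d hd hle
  · have h1 := hδ.rename_swap hij (monomial d 1)
    rw [rename_monomial] at h1
    rw [eq_neg_iff_add_eq_zero, add_comm, ← eq_neg_iff_add_eq_zero] at h1
    rw [h1]
    refine Submodule.neg_mem _ (key _ (hA₁ d hd) ?_)
    rw [mapDomain_perm_apply, mapDomain_perm_apply]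
    simpa using hle

theorem lexMax_mapDomain (d : Fin n →₀ ℕ) (σ : Equiv.Perm (Fin n)) :
    lexMax (d.mapDomain σ) = lexMax d := by
  rw [← lexMax_comp d σ⁻¹]
  congr 1
  funext x
  exact mapDomain_perm_apply d σ x

theorem lexMax_upd₂_lt {i j : Fin n} (hij : i ≠ j) (d : Fin n →₀ ℕ) {t : ℕ} (ht : 0 < t)
    (ht' : t < d i - d j) : lexMax (upd₂ d i j (d j + t) (d i - t)) < lexMax d := by
  rw [coe_upd₂]
  exact lexMax_update_lt hij (by omega) (by omega)

/-- `p` is the monomial with exponent `d` up to monomials with lexicographically smaller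
decreasing rearrangement. -/
def IsLexLead (p : MvPolynomial (Fin n) F) (d : Fin n →₀ ℕ) : Prop :=
  p - monomial d 1 ∈ restrictSupport F {e : Fin n →₀ ℕ | lexMax e < lexMax d}

theorem IsAtomOp.isLexLead {i j : Fin n} (hij : i ≠ j)
    {δ : MvPolynomial (Fin n) F →ₗ[F] MvPolynomial (Fin n) F} (hδ : IsAtomOp i j δ)
    {p : MvPolynomial (Fin n) F} {d : Fin n →₀ ℕ} (hp : IsLexLead p d) (hd : d j < d i) :
    IsLexLead (δ p) (d.mapDomain (Equiv.swap i j)) := by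
  rw [IsLexLead, lexMax_mapDomain]
  have h1 : δ (p - monomial d 1)
      ∈ restrictSupport F {e : Fin n →₀ ℕ | lexMax e < lexMax d} := by
    refine hδ.mem_restrictSupport hij (fun e he => ?_) (fun e he hle t ht => ?_) hp
    · rwa [Set.mem_ofPred_eq, lexMax_mapDomain]
    · rcases Nat.eq_zero_or_pos t with rfl | ht0
      · rw [add_zero, tsub_zero, upd₂_swap hij, Set.mem_ofPred_eq, lexMax_mapDomain]
        exact he
      · exact (lexMax_upd₂_lt hij e ht0 ht).trans he
  have h2 : δ (monomial d 1) - monomial (d.mapDomain (Equiv.swap i j)) 1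
      ∈ restrictSupport F {e : Fin n →₀ ℕ | lexMax e < lexMax d} := by
    rw [hδ.monomial_of_le hij hd.le]
    obtain ⟨m, hm⟩ : ∃ m, d i - d j = m + 1 := ⟨d i - d j - 1, by omega⟩
    rw [hm, Finset.sum_range_succ', add_zero, tsub_zero, upd₂_swap hij, add_sub_cancel_right]
    refine Submodule.sum_mem _ fun t ht => ?_
    rw [monomial_mem_restrictSupport]
    refine Or.inl (lexMax_upd₂_lt hij d t.succ_pos ?_)
    rw [Finset.mem_range] at ht
    omega
  rw [map_sub] at h1
  convert Submodule.add_mem _ h1 h2 using 1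
  ring

/-- Atom operators preserve the span of the monomials involving at least `h` variables. -/
theorem IsAtomOp.mem_card_support {i j : Fin n} (hij : i ≠ j)
    {δ : MvPolynomial (Fin n) F →ₗ[F] MvPolynomial (Fin n) F} (hδ : IsAtomOp i j δ) (h : ℕ)
    {f : MvPolynomial (Fin n) F}
    (hf : f ∈ restrictSupport F {e : Fin n →₀ ℕ | h ≤ e.support.card}) :
    δ f ∈ restrictSupport F {e : Fin n →₀ ℕ | h ≤ e.support.card} := by
  have hmap : ∀ e : Fin n →₀ ℕ,
      (e.mapDomain (Equiv.swap i j)).support.card = e.support.card := by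
    intro e
    rw [Finsupp.mapDomain_support_of_injective (Equiv.swap i j).injective,
      Finset.card_image_of_injective _ (Equiv.swap i j).injective]
  refine hδ.mem_restrictSupport hij (fun e he => ?_) (fun e he hle t ht => ?_) hf
  · rwa [Set.mem_ofPred_eq, hmap]
  · have he' : h ≤ e.support.card := he
    refine le_trans he' ?_
    rw [← hmap e]
    apply Finset.card_le_card
    intro x
    rw [Finsupp.mem_support_iff, Finsupp.mem_support_iff, ← upd₂_swap hij, coe_upd₂, coe_upd₂]
    rcases eq_or_ne x j with rfl | hj
    · simp; omega
    rcases eq_or_ne x i with rfl | hi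
    · simp [hij]; omega
    · simp [hi, hj]

end Atom

section Permutations

variable {n : ℕ}

theorem sw_of_lt {i : ℕ} (hi : i + 1 < n) :
    sw n i = Equiv.swap ⟨i, Nat.lt_of_succ_lt hi⟩ ⟨i + 1, hi⟩ := dif_pos hi

theorem invNum_one : invNum (1 : Equiv.Perm (Fin n)) = 0 := by
  rw [invNum, Finset.card_eq_zero, Finset.filter_eq_empty_iff]
  rintro ⟨a, b⟩ - ⟨h1, h2⟩
  exact lt_asymm h1 h2

/-- An adjacent transposition reverses only one pair. -/
theorem sw_lt_sw {i : ℕ} (hi : i + 1 < n) {a b : Fin n} (hab : a < b)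
    (h : ¬ ((a : ℕ) = i ∧ (b : ℕ) = i + 1)) : sw n i a < sw n i b := by
  rw [sw_of_lt hi, Equiv.swap_apply_def, Equiv.swap_apply_def]
  rw [Fin.lt_def] at hab
  split_ifs with h1 h2 h3 h4 h5 h6 h7 h8 <;>
    simp only [Fin.lt_def, Fin.ext_iff] at * <;> omega

theorem sw_mul_inversion {i : ℕ} (hi : i + 1 < n) {u : Equiv.Perm (Fin n)} {p q : Fin n}
    (h : (sw n i * u) q < (sw n i * u) p) :
    u q < u p ∨ ((u p : ℕ) = i ∧ (u q : ℕ) = i + 1) := by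
  by_contra! hc
  rcases hc.1.lt_or_eq with h1 | h1
  · exact lt_asymm h (sw_lt_sw hi h1 fun h2 => hc.2 h2.1 h2.2)
  · rw [Equiv.Perm.mul_apply, Equiv.Perm.mul_apply, h1] at h
    exact lt_irrefl _ h

theorem invNum_sw_mul_le {i : ℕ} (hi : i + 1 < n) (u : Equiv.Perm (Fin n)) :
    invNum (sw n i * u) ≤ invNum u + 1 := by
  refine le_trans (Finset.card_le_card ?_) (Finset.card_insert_le
    (u⁻¹ ⟨i, Nat.lt_of_succ_lt hi⟩, u⁻¹ ⟨i + 1, hi⟩) _)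
  rintro ⟨p, q⟩ hpq
  rw [Finset.mem_filter] at hpq
  rw [Finset.mem_insert, Finset.mem_filter]
  rcases sw_mul_inversion hi hpq.2.2 with h | ⟨h1, h2⟩
  · exact Or.inr ⟨Finset.mem_univ _, hpq.2.1, h⟩
  · left
    rw [Prod.mk.injEq, Equiv.Perm.eq_inv_iff_eq, Equiv.Perm.eq_inv_iff_eq]
    exact ⟨Fin.ext h1, Fin.ext h2⟩

theorem invNum_sw_mul_le_of_lt {i : ℕ} (hi : i + 1 < n) {u : Equiv.Perm (Fin n)}
    (hu : u⁻¹ ⟨i + 1, hi⟩ < u⁻¹ ⟨i, Nat.lt_of_succ_lt hi⟩) :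
    invNum (sw n i * u) ≤ invNum u := by
  refine Finset.card_le_card ?_
  rintro ⟨p, q⟩ hpq
  rw [Finset.mem_filter] at hpq ⊢
  rcases sw_mul_inversion hi hpq.2.2 with h | ⟨h1, h2⟩
  · exact ⟨Finset.mem_univ _, hpq.2.1, h⟩
  · exfalso
    have e1 : u⁻¹ ⟨i, Nat.lt_of_succ_lt hi⟩ = p := by
      rw [Equiv.Perm.inv_eq_iff_eq]; exact Fin.ext h1.symm
    have e2 : u⁻¹ ⟨i + 1, hi⟩ = q := by
      rw [Equiv.Perm.inv_eq_iff_eq]; exact Fin.ext h2.symm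
    rw [e1, e2] at hu
    exact lt_asymm hu hpq.2.1

theorem invNum_prod_le (l : List ℕ) (hl : ∀ i ∈ l, i + 1 < n) :
    invNum (l.map (sw n)).prod ≤ l.length := by
  induction l with
  | nil => simp [invNum_one]
  | cons i l ih =>
    rw [List.map_cons, List.prod_cons, List.length_cons]
    have h1 := invNum_sw_mul_le (hl i List.mem_cons_self) (l.map (sw n)).prod
    have h2 := ih fun j hj => hl j (List.mem_cons_of_mem _ hj)
    omega

/-- Along a reduced word for `w`, atom operators move the leading exponent `f` to `w · f`, provided
`f` separates the inversions of `w`. -/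
theorem isLexLead_foldr {F : Type*} [Field F]
    {D : ℕ → MvPolynomial (Fin n) F → MvPolynomial (Fin n) F}
    (hD : ∀ (i : ℕ) (hi : i + 1 < n),
      ∃ δ : MvPolynomial (Fin n) F →ₗ[F] MvPolynomial (Fin n) F,
        IsAtomOp ⟨i, Nat.lt_of_succ_lt hi⟩ ⟨i + 1, hi⟩ δ ∧ ∀ f, δ f = D i f)
    {f : Fin n →₀ ℕ} (hf : Antitone f) (l : List ℕ) (hl : ∀ i ∈ l, i + 1 < n)
    (hlen : l.length = invNum (l.map (sw n)).prod)
    (hsep : ∀ p q, p < q → (l.map (sw n)).prod q < (l.map (sw n)).prod p → f p ≠ f q) :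
    IsLexLead (l.foldr D (monomial f 1)) (f.mapDomain (l.map (sw n)).prod) := by
  induction l with
  | nil =>
    have : f.mapDomain (⇑(1 : Equiv.Perm (Fin n))) = f := by
      rw [Equiv.Perm.coe_one, Finsupp.mapDomain_id]
    rw [List.map_nil, List.prod_nil, this, IsLexLead, List.foldr_nil, sub_self]
    exact Submodule.zero_mem _
  | cons i l ih =>
    rw [List.map_cons, List.prod_cons] at hlen hsep ⊢
    rw [List.length_cons] at hlen
    set u := (l.map (sw n)).prod with hu
    have hi := hl i List.mem_cons_self
    have hl' : ∀ j ∈ l, j + 1 < n := fun j hj => hl j (List.mem_cons_of_mem _ hj)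
    have h1 := invNum_sw_mul_le hi u
    have h2 : invNum u ≤ l.length := invNum_prod_le l hl'
    have hui : u⁻¹ ⟨i, Nat.lt_of_succ_lt hi⟩ < u⁻¹ ⟨i + 1, hi⟩ := by
      by_contra! hc
      rcases hc.lt_or_eq with hc | hc
      · have := invNum_sw_mul_le_of_lt hi hc
        omega
      · have := u⁻¹.injective hc
        simp at this
    have hsw : ∀ a b : Fin n, a < b → u b < u a → (sw n i * u) b < (sw n i * u) a := by
      intro a b hab hba
      refine sw_lt_sw hi hba ?_
      rintro ⟨e1, e2⟩
      have e1' : u⁻¹ ⟨i, Nat.lt_of_succ_lt hi⟩ = b := by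
        rw [Equiv.Perm.inv_eq_iff_eq]; exact Fin.ext e1.symm
      have e2' : u⁻¹ ⟨i + 1, hi⟩ = a := by
        rw [Equiv.Perm.inv_eq_iff_eq]; exact Fin.ext e2.symm
      rw [e1', e2'] at hui
      exact lt_asymm hui hab
    have ih' := ih hl' (by omega) fun p q hpq hqp => hsep p q hpq (hsw p q hpq hqp)
    obtain ⟨δ, hδ, hδD⟩ := hD i hi
    have hne : (⟨i, Nat.lt_of_succ_lt hi⟩ : Fin n) ≠ ⟨i + 1, hi⟩ := by simp
    have hstep := hδ.isLexLead hne ih' (by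
      rw [mapDomain_perm_apply, mapDomain_perm_apply]
      refine lt_of_le_of_ne (hf hui.le) (hsep _ _ hui ?_).symm
      have e : ∀ x, u (u⁻¹ x) = x := fun x => by simp
      rw [Equiv.Perm.mul_apply, Equiv.Perm.mul_apply, e, e, sw_of_lt hi,
        Equiv.swap_apply_left, Equiv.swap_apply_right]
      simp [Fin.lt_def])
    rw [hδD, ← sw_of_lt hi, ← Finsupp.mapDomain_comp] at hstep
    exact hstep

theorem foldr_mem_card_support {F : Type*} [Field F]
    {D : ℕ → MvPolynomial (Fin n) F → MvPolynomial (Fin n) F}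
    (hD : ∀ (i : ℕ) (hi : i + 1 < n),
      ∃ δ : MvPolynomial (Fin n) F →ₗ[F] MvPolynomial (Fin n) F,
        IsAtomOp ⟨i, Nat.lt_of_succ_lt hi⟩ ⟨i + 1, hi⟩ δ ∧ ∀ f, δ f = D i f)
    {h : ℕ} {f : MvPolynomial (Fin n) F}
    (hf : f ∈ restrictSupport F {e : Fin n →₀ ℕ | h ≤ e.support.card})
    (l : List ℕ) (hl : ∀ i ∈ l, i + 1 < n) :
    l.foldr D f ∈ restrictSupport F {e : Fin n →₀ ℕ | h ≤ e.support.card} := by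
  induction l with
  | nil => exact hf
  | cons i l ih =>
    obtain ⟨δ, hδ, hδD⟩ := hD i (hl i List.mem_cons_self)
    rw [List.foldr_cons, ← hδD]
    exact hδ.mem_card_support (by simp) h (ih fun j hj => hl j (List.mem_cons_of_mem _ hj))

/-- A permutation increases across positions without descents. -/
theorem lt_of_no_descent {w : Equiv.Perm (Fin n)} {p q : Fin n} (hpq : p < q)
    (h : ∀ k ∈ permDes w, ¬ ((p : ℕ) ≤ k ∧ k < q)) : w p < w q := by
  obtain ⟨q, hq⟩ := q
  obtain ⟨p, hp⟩ := p
  rw [Fin.mk_lt_mk] at hpq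
  induction q, Nat.succ_le_of_lt hpq using Nat.le_induction with
  | base =>
    by_contra! hc
    refine h p ?_ ⟨le_rfl, Nat.lt_succ_self p⟩
    rw [permDes, Finset.mem_filter, Finset.mem_range, pval, pval, dif_pos hq, dif_pos hp]
    refine ⟨by omega, ?_⟩
    rw [← Fin.lt_def]
    refine lt_of_le_of_ne hc fun he => ?_
    have := w.injective he
    simp at this
  | succ q hle ih =>
    have hq' : q < n := by omega
    refine (ih hq' (by omega) fun k hk hk' => h k hk ⟨hk'.1, ?_⟩).trans ?_
    · have := hk'.2
      simp only at this ⊢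
      omega
    · by_contra! hc
      refine h q ?_ ⟨?_, Nat.lt_succ_self q⟩
      · rw [permDes, Finset.mem_filter, Finset.mem_range, pval, pval, dif_pos hq, dif_pos hq']
        refine ⟨by omega, ?_⟩
        rw [← Fin.lt_def]
        refine lt_of_le_of_ne hc fun he => ?_
        have := w.injective he
        simp at this
      · simp only; omega

theorem lt_of_mem_permDes {w : Equiv.Perm (Fin n)} {k : ℕ} (hk : k ∈ permDes w) :
    k + 1 < n := by
  rw [permDes, Finset.mem_filter, Finset.mem_range] at hk
  omega

end Permutations

section Leading

variable {n : ℕ} {F : Type*} [Field F]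

/-- The exponent vector of the squarefree monomial `∏ x ∈ T, X x`. -/
noncomputable def indic (T : Finset (Fin n)) : Fin n →₀ ℕ := ∑ x ∈ T, Finsupp.single x 1

theorem indic_apply (T : Finset (Fin n)) (x : Fin n) : indic T x = if x ∈ T then 1 else 0 := by
  simp [indic, Finsupp.finsetSum_apply, Finsupp.single_apply]

theorem indic_injective : Function.Injective (indic (n := n)) := by
  intro S T h
  ext x
  have := DFunLike.congr_fun h x
  rw [indic_apply, indic_apply] at this
  split_ifs at this <;> simp_all

theorem support_indic (T : Finset (Fin n)) : (indic T).support = T := by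
  ext x
  rw [Finsupp.mem_support_iff, indic_apply]
  simp

theorem prod_X_eq_monomial (T : Finset (Fin n)) :
    (∏ x ∈ T, X x : MvPolynomial (Fin n) F) = monomial (indic T) 1 := by
  rw [indic, monomial_sum_one]
  rfl

theorem esymmS_eq_sum_monomial (S : Finset (Fin n)) (r : ℕ) :
    esymmS F S r = ∑ T ∈ S.powersetCard r, monomial (indic T) 1 :=
  Finset.sum_congr rfl fun T _ => prod_X_eq_monomial T

/-- `q` has leading exponent `g`, and no exponent of `q` exceeds `g` rearranged by `w`. -/
def IsWeakLead (q : MvPolynomial (Fin n) F) (g : Fin n →₀ ℕ) (w : Equiv.Perm (Fin n)) : Prop :=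
  coeff g q = 1 ∧ ∀ g' ∈ q.support, lexMax g' ≤ toLex (g ∘ w)

/-- `q` has leading exponent `g` in the total order `refKey`, where `w` is the permutation sorting
`g`. -/
def IsRefLead (q : MvPolynomial (Fin n) F) (g : Fin n →₀ ℕ) (w : Equiv.Perm (Fin n)) : Prop :=
  coeff g q = 1 ∧ ∀ g' ∈ q.support, refKey g' ≤ permKey g w

theorem IsRefLead.isWeakLead {q : MvPolynomial (Fin n) F} {g : Fin n →₀ ℕ}
    {w : Equiv.Perm (Fin n)} (h : IsRefLead q g w) : IsWeakLead q g w :=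
  ⟨h.1, fun g' hg' => lexMax_le_of_refKey_le (h.2 g' hg')⟩

theorem IsWeakLead.coeff_mul {p q : MvPolynomial (Fin n) F} {d g : Fin n →₀ ℕ}
    {w : Equiv.Perm (Fin n)} (hp : IsWeakLead p d w) (hq : IsWeakLead q g w) :
    coeff (d + g) (p * q) = 1 := by
  rw [MvPolynomial.coeff_mul, Finset.sum_eq_single (d, g)]
  · rw [hp.1, hq.1, one_mul]
  · rintro ⟨d', g'⟩ hmem hne
    have hmem : d' + g' = d + g := Finset.HasAntidiagonal.mem_antidiagonal.mp hmem
    by_contra hc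
    have hd' := (le_lexMax d' w).trans
      (hp.2 d' (mem_support_iff.mpr (left_ne_zero_of_mul hc)))
    have hg' := (le_lexMax g' w).trans
      (hq.2 g' (mem_support_iff.mpr (right_ne_zero_of_mul hc)))
    have hsum : toLex (d' ∘ w) + toLex (g' ∘ w) = toLex (d ∘ w) + toLex (g ∘ w) := by
      have : ⇑d' + ⇑g' = ⇑d + ⇑g := by
        rw [← Finsupp.coe_add, ← Finsupp.coe_add]
        exact congrArg _ hmem
      exact congrArg (fun f : Fin n → ℕ => toLex (f ∘ w)) this
    have h := ((add_eq_add_iff_eq_and_eq hd' hg').mp hsum).1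
    have hd : d' = d := by
      ext x
      simpa using congrFun (toLex.injective h) (w⁻¹ x)
    have hg : g' = g := by
      rw [hd] at hmem
      exact add_left_cancel hmem
    exact hne (by rw [hd, hg])
  · intro h
    have hmem : (d, g).1 + (d, g).2 = d + g := rfl
    exact absurd (Finset.HasAntidiagonal.mem_antidiagonal.mpr hmem) h

theorem IsWeakLead.mul {p q : MvPolynomial (Fin n) F} {d g : Fin n →₀ ℕ}
    {w : Equiv.Perm (Fin n)} (hp : IsWeakLead p d w) (hq : IsWeakLead q g w) :
    IsWeakLead (p * q) (d + g) w := by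
  classical
  refine ⟨hp.coeff_mul hq, fun e he => ?_⟩
  obtain ⟨d', hd', g', hg', rfl⟩ := Finset.mem_add.mp (support_mul p q he)
  rw [Finsupp.coe_add]
  exact (lexMax_add_le _ _).trans (add_le_add (hp.2 d' hd') (hq.2 g' hg'))

theorem IsRefLead.mul {p q : MvPolynomial (Fin n) F} {d g : Fin n →₀ ℕ}
    {w : Equiv.Perm (Fin n)} (hp : IsRefLead p d w) (hq : IsWeakLead q g w) :
    IsRefLead (p * q) (d + g) w := by
  classical
  refine ⟨hp.isWeakLead.coeff_mul hq, fun e he => ?_⟩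
  obtain ⟨d', hd', g', hg', rfl⟩ := Finset.mem_add.mp (support_mul p q he)
  rw [Finsupp.coe_add, Finsupp.coe_add]
  exact refKey_add_le (hp.2 d' hd') (hq.2 g' hg')

theorem isWeakLead_one (w : Equiv.Perm (Fin n)) :
    IsWeakLead (1 : MvPolynomial (Fin n) F) 0 w := by
  refine ⟨coeff_zero_one, fun g' hg' => ?_⟩
  rw [support_one, Finset.mem_singleton] at hg'
  subst hg'
  obtain ⟨σ, hσ⟩ := exists_lexMax_eq (⇑(0 : Fin n →₀ ℕ))
  rw [hσ]
  exact le_of_eq rfl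

theorem IsWeakLead.pow {q : MvPolynomial (Fin n) F} {g : Fin n →₀ ℕ}
    {w : Equiv.Perm (Fin n)} (hq : IsWeakLead q g w) (m : ℕ) :
    IsWeakLead (q ^ m) (m • g) w := by
  induction m with
  | zero => simpa using isWeakLead_one w
  | succ m ih => rw [pow_succ, succ_nsmul]; exact ih.mul hq

theorem isWeakLead_prod {ι : Type*} (s : Finset ι) {q : ι → MvPolynomial (Fin n) F}
    {g : ι → Fin n →₀ ℕ} {w : Equiv.Perm (Fin n)} (h : ∀ i ∈ s, IsWeakLead (q i) (g i) w) :
    IsWeakLead (∏ i ∈ s, q i) (∑ i ∈ s, g i) w := by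
  classical
  induction s using Finset.induction_on with
  | empty => simpa using isWeakLead_one w
  | insert i s hi ih =>
    rw [Finset.prod_insert hi, Finset.sum_insert hi]
    exact (h i (Finset.mem_insert_self i s)).mul
      (ih fun j hj => h j (Finset.mem_insert_of_mem hj))

/-- The exponent vector of the monomial `X (w 0) * ⋯ * X (w k)`. -/
noncomputable def prefixExp (w : Equiv.Perm (Fin n)) (k : Fin n) : Fin n →₀ ℕ :=
  indic ((Finset.Iic k).map w.toEmbedding)

theorem prefixExp_apply (w : Equiv.Perm (Fin n)) (k j : Fin n) :
    prefixExp w k (w j) = if j ≤ k then 1 else 0 := by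
  rw [prefixExp, indic_apply]
  simp

theorem isWeakLead_esymmS (w : Equiv.Perm (Fin n)) (k : Fin n) :
    IsWeakLead (esymmS F Finset.univ (k + 1)) (prefixExp w k) w := by
  classical
  rw [esymmS_eq_sum_monomial]
  constructor
  · rw [coeff_sum, Finset.sum_eq_single ((Finset.Iic k).map w.toEmbedding)]
    · rw [prefixExp, coeff_monomial, if_pos rfl]
    · intro T _ hT
      rw [prefixExp, coeff_monomial, if_neg fun h => hT (indic_injective h)]
    · intro h
      exact absurd (Finset.mem_powersetCard.mpr ⟨Finset.subset_univ _, by simp⟩) h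
  · intro g hg
    obtain ⟨T, hT, hgT⟩ := Finset.mem_biUnion.mp (support_sum hg)
    rw [Finset.mem_powersetCard] at hT
    have hgT := support_monomial_subset hgT
    rw [Finset.mem_singleton] at hgT
    subst hgT
    obtain ⟨σ, hσ⟩ := exists_lexMax_eq (indic T)
    rw [hσ]
    by_contra! hlt
    obtain ⟨i, hi, hlt⟩ := hlt
    simp only [Pi.toLex_apply, Function.comp_apply, prefixExp_apply, indic_apply] at hi hlt
    have hki : k < i ∧ σ i ∈ T := by
      split_ifs at hlt with h1 h2
      · omega
      · omega
      · exact ⟨not_le.mp h1, by assumption⟩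
      · omega
    have hsub : ((insert i (Finset.Iic k)).map σ.toEmbedding) ⊆ T := by
      intro x hx
      obtain ⟨j, hj, rfl⟩ := Finset.mem_map.mp hx
      rcases Finset.mem_insert.mp hj with rfl | hj
      · exact hki.2
      · have hj' := Finset.mem_Iic.mp hj
        have := hi j (hj'.trans_lt hki.1)
        rw [if_pos hj'] at this
        by_contra hc
        have hc' : σ j ∉ T := hc
        rw [if_neg hc'] at this
        omega
    have hcard := Finset.card_le_card hsub
    rw [Finset.card_map, Finset.card_insert_of_notMem (by simpa using hki.1), Fin.card_Iic,
      hT.2] at hcard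
    omega

/-- The exponent vector of `x_{D(w)}`. -/
noncomputable def desExp (w : Equiv.Perm (Fin n)) : Fin n →₀ ℕ :=
  Finsupp.equivFunOnFinite.symm (expI n (permDes w))

theorem xI_eq_monomial (w : Equiv.Perm (Fin n)) :
    xI F n (permDes w) = monomial (desExp w) 1 := by
  rw [xI, monomial_eq, C_1, one_mul, Finsupp.prod_fintype _ _ fun i => pow_zero _]
  rfl

theorem expI_antitone (I : Finset ℕ) : Antitone (expI n I) := by
  intro i j hij
  refine Finset.card_le_card fun k hk => ?_
  rw [Finset.mem_filter] at hk ⊢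
  exact ⟨hk.1, le_trans (Fin.le_def.mp hij) hk.2⟩

theorem not_mem_of_expI_eq {I : Finset ℕ} {i j : Fin n} (hij : i ≤ j)
    (h : expI n I i = expI n I j) : ∀ k ∈ I, ¬ ((i : ℕ) ≤ k ∧ k < j) := by
  rintro k hk ⟨h1, h2⟩
  have hsub : (I.filter fun k => (j : ℕ) ≤ k) ⊆ I.filter fun k => (i : ℕ) ≤ k := by
    intro k hk
    rw [Finset.mem_filter] at hk ⊢
    exact ⟨hk.1, le_trans (Fin.le_def.mp hij) hk.2⟩
  have heq := Finset.eq_of_subset_of_card_le hsub h.le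
  have : k ∈ I.filter fun k => (j : ℕ) ≤ k := heq ▸ Finset.mem_filter.mpr ⟨hk, h1⟩
  exact absurd (Finset.mem_filter.mp this).2 (not_le.mpr h2)

/-- The leading exponent of `π̄_w(x_{D(w)}) · e_1 ^ c_0 ⋯ e_n ^ c_{n-1}`. -/
noncomputable def leadExp (wc : Equiv.Perm (Fin n) × (Fin n → ℕ)) : Fin n →₀ ℕ :=
  (desExp wc.1).mapDomain wc.1 + ∑ k, wc.2 k • prefixExp wc.1 k

theorem leadExp_apply (w : Equiv.Perm (Fin n)) (c : Fin n → ℕ) (j : Fin n) :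
    leadExp (w, c) (w j) = expI n (permDes w) j + ∑ k ∈ Finset.Ici j, c k := by
  rw [leadExp, Finsupp.add_apply, mapDomain_perm_apply, Finsupp.finsetSum_apply]
  congr 1
  · simp [desExp]
  · simp only [Finsupp.smul_apply, prefixExp_apply, smul_eq_mul, mul_ite, mul_one, mul_zero]
    rw [← Finset.sum_filter]
    congr 1
    ext k
    simp

theorem sum_Ici_antitone (c : Fin n → ℕ) : Antitone fun j => ∑ k ∈ Finset.Ici j, c k :=
  fun _ _ hij => Finset.sum_le_sum_of_subset (Finset.Ici_subset_Ici.mpr hij)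

theorem leadExp_comp_antitone (w : Equiv.Perm (Fin n)) (c : Fin n → ℕ) :
    Antitone (leadExp (w, c) ∘ w) := by
  intro i j hij
  simp only [Function.comp_apply, leadExp_apply]
  exact add_le_add (expI_antitone _ hij) (sum_Ici_antitone c hij)

theorem lt_of_leadExp_eq (w : Equiv.Perm (Fin n)) (c : Fin n → ℕ) (i j : Fin n) (hij : i < j)
    (h : leadExp (w, c) (w i) = leadExp (w, c) (w j)) : w i < w j := by
  rw [leadExp_apply, leadExp_apply] at h
  have h1 := expI_antitone (permDes w) hij.le
  have h2 := sum_Ici_antitone c hij.le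
  simp only at h2
  exact lt_of_no_descent hij (not_mem_of_expI_eq hij.le (by omega))

theorem eq_sort_leadExp (w : Equiv.Perm (Fin n)) (c : Fin n → ℕ) :
    w = Tuple.sort (OrderDual.toDual ∘ leadExp (w, c)) := by
  rw [Tuple.eq_sort_iff]
  refine ⟨fun i j hij => ?_, fun i j hij h => ?_⟩
  · exact leadExp_comp_antitone w c hij
  · exact lt_of_leadExp_eq w c i j hij h

theorem sum_Ici_eq_add (c : Fin n → ℕ) (j : Fin n) :
    ∑ k ∈ Finset.Ici j, c k = c j + ∑ k ∈ Finset.Ioi j, c k := by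
  rw [← Finset.Ioi_insert, Finset.sum_insert (by simp)]

theorem leadExp_injective : Function.Injective (leadExp (n := n)) := by
  rintro ⟨w, c⟩ ⟨w', c'⟩ h
  have hw : w = w' := by
    rw [eq_sort_leadExp w c, eq_sort_leadExp w' c', h]
  subst hw
  refine Prod.ext rfl (funext fun j => ?_)
  induction j using WellFoundedGT.induction with
  | ind j ih =>
    have h1 := DFunLike.congr_fun h (w j)
    rw [leadExp_apply, leadExp_apply, sum_Ici_eq_add, sum_Ici_eq_add,
      Finset.sum_congr rfl fun k hk => ih k (Finset.mem_Ioi.mp hk)] at h1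
    simp only at *
    omega

theorem exists_sum_Ici_eq {ψ : Fin n → ℕ} (hψ : Antitone ψ) :
    ∃ c : Fin n → ℕ, ∀ j, ∑ k ∈ Finset.Ici j, c k = ψ j := by
  let Ψ : ℕ → ℕ := fun m => if h : m < n then ψ ⟨m, h⟩ else 0
  refine ⟨fun k => ψ k - Ψ (k + 1), fun j => ?_⟩
  induction j using WellFoundedGT.induction with
  | ind j ih =>
    rw [sum_Ici_eq_add]
    by_cases hj : (j : ℕ) + 1 < n
    · have hI : Finset.Ioi j = Finset.Ici ⟨j + 1, hj⟩ := by
        ext k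
        simp only [Finset.mem_Ioi, Finset.mem_Ici, Fin.lt_def, Fin.le_def]
        omega
      have hlt : j < ⟨j + 1, hj⟩ := Nat.lt_succ_self j
      rw [hI, ih _ hlt]
      simp only [Ψ, dif_pos hj]
      exact Nat.sub_add_cancel (hψ hlt.le)
    · have hI : Finset.Ioi j = ∅ := by
        ext k
        simp only [Finset.mem_Ioi, Fin.lt_def, Finset.notMem_empty, iff_false]
        omega
      rw [hI]
      simp [Ψ, dif_neg hj]

theorem expI_succ {w : Equiv.Perm (Fin n)} {j : ℕ} (hj : j + 1 < n) :
    expI n (permDes w) ⟨j, Nat.lt_of_succ_lt hj⟩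
      = expI n (permDes w) ⟨j + 1, hj⟩ + if j ∈ permDes w then 1 else 0 := by
  rw [expI, expI]
  split_ifs with h
  · rw [← Finset.card_insert_of_notMem (a := j) (by simp)]
    congr 1
    ext k
    simp only [Finset.mem_filter, Finset.mem_insert]
    constructor
    · rintro ⟨h1, h2⟩
      rcases h2.lt_or_eq with h2 | h2
      · exact Or.inr ⟨h1, h2⟩
      · exact Or.inl h2.symm
    · rintro (rfl | ⟨h1, h2⟩)
      · exact ⟨h, le_rfl⟩
      · exact ⟨h1, by omega⟩
  · rw [add_zero]
    congr 1
    ext k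
    simp only [Finset.mem_filter]
    refine and_congr_right fun h1 => ⟨fun h2 => ?_, fun h2 => by omega⟩
    have : k ≠ j := by rintro rfl; exact h h1
    omega

theorem expI_last (w : Equiv.Perm (Fin n)) {j : Fin n} (hj : (j : ℕ) + 1 = n) :
    expI n (permDes w) j = 0 := by
  rw [expI, Finset.card_eq_zero, Finset.filter_eq_empty_iff]
  intro k hk
  have := lt_of_mem_permDes hk
  omega

theorem expI_sub_le {w : Equiv.Perm (Fin n)} {φ : Fin n → ℕ} (hφ : Antitone φ)
    (hφ' : ∀ i j, i < j → φ i = φ j → w i < w j) {i j : Fin n} (hij : i ≤ j) :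
    φ j + expI n (permDes w) i ≤ φ i + expI n (permDes w) j := by
  obtain ⟨j, hj⟩ := j
  obtain ⟨i, hi⟩ := i
  rw [Fin.mk_le_mk] at hij
  induction j, hij using Nat.le_induction with
  | base => exact le_rfl
  | succ j hle ih =>
    have h1 := ih (by omega)
    have h2 := expI_succ (w := w) hj
    have hlt : (⟨j, by omega⟩ : Fin n) < ⟨j + 1, hj⟩ := by simp [Fin.lt_def]
    have h3 := hφ hlt.le
    split_ifs at h2 with h
    · have h4 : φ ⟨j, by omega⟩ ≠ φ ⟨j + 1, hj⟩ := by
        intro he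
        have h5 := hφ' _ _ hlt he
        rw [permDes, Finset.mem_filter, pval, pval, dif_pos hj, dif_pos (by omega)] at h
        exact lt_asymm h.2 h5
      omega
    · omega

theorem leadExp_surjective : Function.Surjective (leadExp (n := n)) := by
  intro d
  set w := Tuple.sort (OrderDual.toDual ∘ d) with hw
  obtain ⟨h1, h2⟩ := Tuple.eq_sort_iff.mp hw
  have hφ : Antitone fun j => d (w j) := fun i j hij => h1 hij
  have hφ' : ∀ i j, i < j → d (w i) = d (w j) → w i < w j := fun i j hij h => h2 i j hij h
  have hle : ∀ j, expI n (permDes w) j ≤ d (w j) := by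
    intro j
    have hlast : n - 1 < n := by have := j.isLt; omega
    have h := expI_sub_le hφ hφ' (i := j) (j := ⟨n - 1, hlast⟩) (by rw [Fin.le_def]; simp; omega)
    rw [expI_last w (j := ⟨n - 1, hlast⟩) (by simp; omega)] at h
    omega
  obtain ⟨c, hc⟩ := exists_sum_Ici_eq (ψ := fun j => d (w j) - expI n (permDes w) j) (by
    intro i j hij
    have h := expI_sub_le hφ hφ' hij
    have h3 := hle i
    have h4 := hle j
    simp only at h ⊢
    omega)
  refine ⟨(w, c), Finsupp.ext fun x => ?_⟩
  obtain ⟨j, rfl⟩ := w.surjective x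
  rw [leadExp_apply, hc]
  have := hle j
  omega

end Leading

section Triangular

variable {n : ℕ} {F : Type*} [Field F] {ι : Type*} {G : ι → MvPolynomial (Fin n) F}
  {L : ι → Fin n →₀ ℕ} {W : ι → Equiv.Perm (Fin n)}

theorem linearIndependent_of_isRefLead (hL : Function.Injective L)
    (hG : ∀ i, IsRefLead (G i) (L i) (W i)) : LinearIndependent F G := by
  classical
  rw [linearIndependent_iff']
  intro s g hsum
  by_contra! hc
  obtain ⟨i₀, hi₀, hgi₀⟩ := hc
  obtain ⟨i, hi, hmax⟩ := (s.filter fun i => g i ≠ 0).exists_max_image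
    (fun i => refKey (L i)) ⟨i₀, Finset.mem_filter.mpr ⟨hi₀, hgi₀⟩⟩
  rw [Finset.mem_filter] at hi
  have h := congrArg (coeff (L i)) hsum
  rw [coeff_sum, coeff_zero, Finset.sum_eq_single i] at h
  · rw [coeff_smul, (hG i).1, smul_eq_mul, mul_one] at h
    exact hi.2 h
  · intro j hj hji
    rw [coeff_smul, smul_eq_mul]
    by_contra hne
    have h1 := hmax j (Finset.mem_filter.mpr ⟨hj, left_ne_zero_of_mul hne⟩)
    have h2 := ((hG j).2 (L i) (mem_support_iff.mpr (right_ne_zero_of_mul hne))).trans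
      (permKey_le_refKey _ _)
    exact hji (hL (DFunLike.coe_injective (refKey_injective (le_antisymm h1 h2))))
  · intro hi'
    exact absurd hi.1 hi'

theorem restrictSupport_le_span (hG : ∀ i, IsRefLead (G i) (L i) (W i)) {A : Set (Fin n →₀ ℕ)}
    {J : Set ι} (hA : ∀ d ∈ A, ∃ i ∈ J, L i = d ∧ G i ∈ restrictSupport F A) :
    restrictSupport F A ≤ Submodule.span F (G '' J) := by
  rw [restrictSupport_eq_span, Submodule.span_le]
  rintro _ ⟨d, hd, rfl⟩
  have hwf : WellFounded (InvImage (· < ·) fun d : Fin n →₀ ℕ => refKey d) :=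
    InvImage.wf _ wellFounded_lt
  induction d using hwf.induction with
  | _ d ih =>
    obtain ⟨i, hi, rfl, hGA⟩ := hA d hd
    have hrest : G i - monomial (L i) 1 ∈ Submodule.span F (G '' J) := by
      rw [as_sum (G i - monomial (L i) 1)]
      refine Submodule.sum_mem _ fun e he => ?_
      rw [mem_support_iff, coeff_sub, coeff_monomial] at he
      have hne : L i ≠ e := by
        rintro rfl
        rw [(hG i).1, if_pos rfl, sub_self] at he
        exact he rfl
      rw [if_neg hne, sub_zero, ← mem_support_iff] at he
      have hle := ((hG i).2 e he).trans (permKey_le_refKey _ _)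
      have hlt : refKey e < refKey (L i) := lt_of_le_of_ne hle fun h =>
        hne (DFunLike.coe_injective (refKey_injective h)).symm
      have := ih e hlt (hGA he)
      rw [← mul_one (coeff e _), ← smul_eq_mul, ← smul_monomial]
      exact Submodule.smul_mem _ _ this
    have := Submodule.sub_mem _ (Submodule.subset_span (Set.mem_image_of_mem G hi)) hrest
    rwa [sub_sub_cancel] at this

end Triangular

section Tanisaki

variable {n : ℕ} {F : Type*} [Field F]

theorem mul_mem_card_support {h : ℕ} (g : MvPolynomial (Fin n) F) {f : MvPolynomial (Fin n) F}
    (hf : f ∈ restrictSupport F {e : Fin n →₀ ℕ | h ≤ e.support.card}) :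
    g * f ∈ restrictSupport F {e : Fin n →₀ ℕ | h ≤ e.support.card} := by
  classical
  intro e he
  obtain ⟨d, -, e', he', rfl⟩ := Finset.mem_add.mp (support_mul g f he)
  have h1 : h ≤ e'.support.card := hf he'
  refine h1.trans (Finset.card_le_card fun x hx => ?_)
  rw [Finsupp.mem_support_iff] at hx ⊢
  rw [Finsupp.add_apply]
  omega

theorem esymmS_mem_card_support {h r : ℕ} (hr : h ≤ r) (S : Finset (Fin n)) :
    esymmS F S r ∈ restrictSupport F {e : Fin n →₀ ℕ | h ≤ e.support.card} := by
  rw [esymmS_eq_sum_monomial]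
  refine Submodule.sum_mem _ fun T hT => ?_
  rw [monomial_mem_restrictSupport]
  left
  rw [Set.mem_ofPred_eq, support_indic, (Finset.mem_powersetCard.mp hT).2]
  exact hr

theorem card_filter_hook {h : ℕ} {μ : n.Partition}
    (hμ : μ.parts = (n - h + 1) ::ₘ Multiset.replicate (h - 1) 1) (i : ℕ) :
    (μ.parts.filter fun p => i ≤ p).card
      = (if i ≤ n - h + 1 then 1 else 0) + if i ≤ 1 then h - 1 else 0 := by
  rw [hμ, Multiset.filter_cons, Multiset.card_add]
  congr 1
  · split_ifs <;> simp
  · split_ifs with h1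
    · rw [Multiset.filter_eq_self.mpr, Multiset.card_replicate]
      intro a ha
      rwa [Multiset.eq_of_mem_replicate ha]
    · rw [Multiset.card_eq_zero, Multiset.filter_eq_nil]
      intro a ha
      rwa [Multiset.eq_of_mem_replicate ha]

theorem dk_hook_of_lt {h : ℕ} (hhn : h ≤ n) {μ : n.Partition}
    (hμ : μ.parts = (n - h + 1) ::ₘ Multiset.replicate (h - 1) 1) {k : ℕ} (hk : k < n) :
    dk n μ k = k + 1 - h := by
  have h1 : ∀ i ∈ Finset.Icc (n + 1 - k) n, (μ.parts.filter fun p => i ≤ p).card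
      = if i ≤ n - h + 1 then 1 else 0 := by
    intro i hi
    rw [Finset.mem_Icc] at hi
    rw [card_filter_hook hμ, if_neg (c := i ≤ 1) (by omega), add_zero]
  rw [dk, Finset.sum_congr rfl h1, ← Finset.sum_filter, ← Finset.card_eq_sum_ones]
  have h2 : (Finset.Icc (n + 1 - k) n).filter (fun i => i ≤ n - h + 1)
      ⊆ Finset.Icc (n + 1 - k) (n - h + 1) := by
    intro i hi
    simp only [Finset.mem_filter, Finset.mem_Icc] at hi ⊢
    omega
  rcases Nat.eq_zero_or_pos h with rfl | h0
  · have h3 : (Finset.Icc (n + 1 - k) n).filter (fun i => i ≤ n - 0 + 1)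
        = Finset.Icc (n + 1 - k) n := by
      rw [Finset.filter_eq_self]
      intro i hi
      rw [Finset.mem_Icc] at hi
      omega
    have h4 := congrArg Multiset.sum hμ
    rw [μ.parts_sum] at h4
    simp at h4
  · have h3 : (Finset.Icc (n + 1 - k) n).filter (fun i => i ≤ n - h + 1)
        = Finset.Icc (n + 1 - k) (n - h + 1) := by
      ext i
      simp only [Finset.mem_filter, Finset.mem_Icc]
      omega
    rw [h3, Nat.card_Icc]
    omega

theorem dk_hook_self {h : ℕ} (hh : 1 ≤ h) (hhn : h ≤ n) {μ : n.Partition}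
    (hμ : μ.parts = (n - h + 1) ::ₘ Multiset.replicate (h - 1) 1) : dk n μ n = n := by
  rw [dk, Finset.sum_congr rfl fun i _ => card_filter_hook hμ i, Finset.sum_add_distrib,
    ← Finset.sum_filter, ← Finset.sum_filter, ← Finset.card_eq_sum_ones, Finset.sum_const]
  have h1 : (Finset.Icc (n + 1 - n) n).filter (fun i => i ≤ n - h + 1)
      = Finset.Icc 1 (n - h + 1) := by
    ext i
    simp only [Finset.mem_filter, Finset.mem_Icc]
    omega
  have h2 : (Finset.Icc (n + 1 - n) n).filter (fun i => i ≤ 1) = {1} := by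
    ext i
    simp only [Finset.mem_filter, Finset.mem_Icc, Finset.mem_singleton]
    omega
  rw [h1, h2, Nat.card_Icc, Finset.card_singleton]
  simp only [smul_eq_mul, one_mul]
  omega

theorem esymmS_univ_mem_tanisaki {h : ℕ} (hh : 1 ≤ h) (hhn : h ≤ n) {μ : n.Partition}
    (hμ : μ.parts = (n - h + 1) ::ₘ Multiset.replicate (h - 1) 1) (k : Fin n) :
    esymmS F Finset.univ (k + 1) ∈ tanisaki n F μ :=
  Ideal.subset_span ⟨n, k + 1, Finset.univ, by simp, k.isLt,
    by rw [dk_hook_self hh hhn hμ]; omega, rfl⟩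

theorem mem_tanisaki_of_mem_card_support {h : ℕ} (hh : 1 ≤ h) (hhn : h ≤ n) {μ : n.Partition}
    (hμ : μ.parts = (n - h + 1) ::ₘ Multiset.replicate (h - 1) 1) {f : MvPolynomial (Fin n) F}
    (hf : f ∈ restrictSupport F {e : Fin n →₀ ℕ | h ≤ e.support.card}) :
    f ∈ tanisaki n F μ := by
  rw [as_sum f]
  refine Ideal.sum_mem _ fun d hd => ?_
  obtain ⟨S, hS, hcard⟩ := Finset.exists_subset_card_eq (hf hd : h ≤ d.support.card)
  have hmem : esymmS F S h ∈ tanisaki n F μ := by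
    refine Ideal.subset_span ⟨h, h, S, hcard, le_rfl, ?_, rfl⟩
    rcases hhn.lt_or_eq with hlt | rfl
    · rw [dk_hook_of_lt hhn hμ hlt]; omega
    · rw [dk_hook_self hh hhn hμ]; omega
  rw [esymmS_eq_sum_monomial, ← hcard, Finset.powersetCard_self, Finset.sum_singleton] at hmem
  have hle : indic S ≤ d := by
    intro x
    rw [indic_apply]
    split_ifs with hx
    · exact Nat.one_le_iff_ne_zero.mpr (Finsupp.mem_support_iff.mp (hS hx))
    · exact Nat.zero_le _
  have hmul := Ideal.mul_mem_left _ (monomial (d - indic S) (coeff d f)) hmem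
  rwa [monomial_mul, tsub_add_cancel_of_le hle, mul_one] at hmul

theorem card_support_leadExp_lt {h : ℕ} (hh : 1 ≤ h) {w : Equiv.Perm (Fin n)} {c : Fin n → ℕ}
    (hw : permDes w ⊆ Finset.range (h - 1)) (hc : ∀ k : Fin n, h - 1 ≤ k → c k = 0) :
    (leadExp (w, c)).support.card < h := by
  have hsub : (leadExp (w, c)).support
      ⊆ (Finset.univ.filter fun j : Fin n => (j : ℕ) < h - 1).map w.toEmbedding := by
    intro x hx
    obtain ⟨j, rfl⟩ := w.surjective x
    rw [Finsupp.mem_support_iff, leadExp_apply] at hx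
    refine Finset.mem_map.mpr ⟨j, Finset.mem_filter.mpr ⟨Finset.mem_univ _, ?_⟩, rfl⟩
    by_contra! hj
    apply hx
    rw [Nat.add_eq_zero_iff]
    constructor
    · rw [expI, Finset.card_eq_zero, Finset.filter_eq_empty_iff]
      intro k hk
      have := Finset.mem_range.mp (hw hk)
      omega
    · refine Finset.sum_eq_zero fun k hk => hc k ?_
      exact hj.trans (Fin.le_def.mp (Finset.mem_Ici.mp hk))
  have h1 := Finset.card_le_card hsub
  rw [Finset.card_map] at h1
  have h2 : (Finset.univ.filter fun j : Fin n => (j : ℕ) < h - 1).card ≤ h - 1 := by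
    rw [← Finset.card_range (h - 1)]
    refine Finset.card_le_card_of_injOn (fun j => (j : ℕ)) ?_ Fin.val_injective.injOn
    intro j hj
    simpa using hj
  omega

/-- The products of the `a w` with monomials in the elementary symmetric polynomials. -/
noncomputable def symMul (a : Equiv.Perm (Fin n) → MvPolynomial (Fin n) F)
    (wc : Equiv.Perm (Fin n) × (Fin n → ℕ)) : MvPolynomial (Fin n) F :=
  a wc.1 * ∏ k : Fin n, esymmS F Finset.univ (k + 1) ^ wc.2 k

theorem leadExp_zero (w : Equiv.Perm (Fin n)) :
    leadExp (w, (0 : Fin n → ℕ)) = (desExp w).mapDomain w := by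
  simp [leadExp]

theorem isRefLead_of_isLexLead {p : MvPolynomial (Fin n) F} {w : Equiv.Perm (Fin n)}
    (h : IsLexLead p ((desExp w).mapDomain w)) : IsRefLead p ((desExp w).mapDomain w) w := by
  rw [← leadExp_zero] at h ⊢
  set d := leadExp (w, (0 : Fin n → ℕ))
  have hanti := leadExp_comp_antitone w 0
  constructor
  · by_contra hc
    have : d ∈ (p - monomial d 1).support := by
      rw [mem_support_iff, coeff_sub, coeff_monomial, if_pos rfl]
      exact sub_ne_zero.mpr hc
    have hlt : lexMax d < lexMax d := h this
    exact lt_irrefl _ hlt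
  · intro e he
    rcases eq_or_ne d e with rfl | hne
    · exact (refKey_eq_permKey hanti (lt_of_leadExp_eq w 0)).le
    · have : e ∈ (p - monomial d 1).support := by
        rw [mem_support_iff, coeff_sub, coeff_monomial, if_neg hne, sub_zero]
        exact mem_support_iff.mp he
      have hlt : lexMax e < lexMax d := h this
      rw [lexMax_eq_of_antitone hanti] at hlt
      exact (refKey_lt_permKey_of_lexMax_lt hlt).le

theorem isRefLead_symMul {a : Equiv.Perm (Fin n) → MvPolynomial (Fin n) F}
    (ha : ∀ w, IsLexLead (a w) ((desExp w).mapDomain w))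
    (wc : Equiv.Perm (Fin n) × (Fin n → ℕ)) : IsRefLead (symMul a wc) (leadExp wc) wc.1 :=
  (isRefLead_of_isLexLead (ha wc.1)).mul
    (isWeakLead_prod _ fun k _ => (isWeakLead_esymmS wc.1 k).pow (wc.2 k))

theorem esymmS_mul_symMul (a : Equiv.Perm (Fin n) → MvPolynomial (Fin n) F)
    (w : Equiv.Perm (Fin n)) (c : Fin n → ℕ) (k : Fin n) :
    esymmS F Finset.univ (k + 1) * symMul a (w, c) = symMul a (w, c + Pi.single k 1) := by
  simp only [symMul, Pi.add_apply, pow_add, Finset.prod_mul_distrib]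
  have : ∏ j : Fin n, esymmS F (Finset.univ : Finset (Fin n)) (j + 1) ^ (Pi.single k 1 : Fin n → ℕ) j
      = esymmS F Finset.univ (k + 1) := by
    rw [Finset.prod_eq_single k]
    · simp
    · intro j _ hj
      simp [hj]
    · simp
  rw [this]
  ring

theorem symMul_mem_card_support {a : Equiv.Perm (Fin n) → MvPolynomial (Fin n) F} {h : ℕ}
    (ha : ∀ w, ¬ permDes w ⊆ Finset.range (h - 1) →
      a w ∈ restrictSupport F {e : Fin n →₀ ℕ | h ≤ e.support.card})
    {w : Equiv.Perm (Fin n)} {c : Fin n → ℕ}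
    (hwc : permDes w ⊆ Finset.range (h - 1) → ∃ k : Fin n, h - 1 ≤ k ∧ c k ≠ 0) :
    symMul a (w, c) ∈ restrictSupport F {e : Fin n →₀ ℕ | h ≤ e.support.card} := by
  by_cases hw : permDes w ⊆ Finset.range (h - 1)
  · obtain ⟨k, hk, hck⟩ := hwc hw
    have hc : c = (c - Pi.single k 1) + Pi.single k 1 := by
      funext j
      rcases eq_or_ne j k with rfl | hj
      · simp; omega
      · simp [hj]
    rw [hc, ← esymmS_mul_symMul, mul_comm]
    exact mul_mem_card_support _ (esymmS_mem_card_support (by omega) _)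
  · rw [symMul, mul_comm]
    exact mul_mem_card_support _ (ha w hw)

/-- The index set of the part of the basis which survives in the quotient by `I_μ`. -/
def goodIndex (n h : ℕ) : Set (Equiv.Perm (Fin n) × (Fin n → ℕ)) :=
  {wc | permDes wc.1 ⊆ Finset.range (h - 1) ∧ wc.2 = 0}

variable {a : Equiv.Perm (Fin n) → MvPolynomial (Fin n) F} {h : ℕ}

theorem span_symMul_eq_top (ha : ∀ w, IsLexLead (a w) ((desExp w).mapDomain w)) :
    Submodule.span F (symMul a '' Set.univ) = ⊤ := by
  rw [eq_top_iff, ← restrictSupport_univ]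
  refine restrictSupport_le_span (isRefLead_symMul ha) fun d _ => ?_
  obtain ⟨wc, hwc⟩ := leadExp_surjective d
  exact ⟨wc, Set.mem_univ _, hwc, fun _ _ => Set.mem_univ _⟩

theorem card_support_le_span (ha : ∀ w, IsLexLead (a w) ((desExp w).mapDomain w))
    (ha' : ∀ w, ¬ permDes w ⊆ Finset.range (h - 1) →
      a w ∈ restrictSupport F {e : Fin n →₀ ℕ | h ≤ e.support.card}) (hh : 1 ≤ h) :
    restrictSupport F {e : Fin n →₀ ℕ | h ≤ e.support.card}
      ≤ Submodule.span F (symMul a '' (goodIndex n h)ᶜ) := by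
  refine restrictSupport_le_span (isRefLead_symMul ha) fun d hd => ?_
  obtain ⟨⟨w, c⟩, rfl⟩ := leadExp_surjective d
  have hwc : permDes w ⊆ Finset.range (h - 1) → ∃ k : Fin n, h - 1 ≤ k ∧ c k ≠ 0 := by
    intro hw
    by_contra! hc
    exact absurd hd (not_le.mpr (card_support_leadExp_lt hh hw hc))
  refine ⟨(w, c), fun hgood => ?_, rfl, symMul_mem_card_support ha' hwc⟩
  obtain ⟨k, -, hk⟩ := hwc hgood.1
  exact hk (congrFun hgood.2 k)

theorem symMul_mem_tanisaki (ha' : ∀ w, ¬ permDes w ⊆ Finset.range (h - 1) →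
      a w ∈ restrictSupport F {e : Fin n →₀ ℕ | h ≤ e.support.card}) (hh : 1 ≤ h) (hhn : h ≤ n)
    {μ : n.Partition} (hμ : μ.parts = (n - h + 1) ::ₘ Multiset.replicate (h - 1) 1)
    {wc : Equiv.Perm (Fin n) × (Fin n → ℕ)} (hwc : wc ∉ goodIndex n h) :
    symMul a wc ∈ tanisaki n F μ := by
  obtain ⟨w, c⟩ := wc
  by_cases hw : permDes w ⊆ Finset.range (h - 1)
  · have hc : c ≠ 0 := fun hc => hwc ⟨hw, hc⟩
    obtain ⟨k, hk⟩ := Function.ne_iff.mp hc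
    rw [Pi.zero_apply] at hk
    refine Ideal.mul_mem_left _ _ (Ideal.prod_mem _ (Finset.mem_univ k) ?_)
    exact Ideal.pow_mem_of_mem _ (esymmS_univ_mem_tanisaki hh hhn hμ k) _ (Nat.pos_of_ne_zero hk)
  · exact mem_tanisaki_of_mem_card_support hh hhn hμ
      (symMul_mem_card_support ha' fun hw' => absurd hw' hw)

theorem tanisaki_le_span (ha : ∀ w, IsLexLead (a w) ((desExp w).mapDomain w))
    (ha' : ∀ w, ¬ permDes w ⊆ Finset.range (h - 1) →
      a w ∈ restrictSupport F {e : Fin n →₀ ℕ | h ≤ e.support.card}) (hh : 1 ≤ h) (hhn : h ≤ n)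
    {μ : n.Partition} (hμ : μ.parts = (n - h + 1) ::ₘ Multiset.replicate (h - 1) 1)
    {f : MvPolynomial (Fin n) F} (hf : f ∈ tanisaki n F μ) :
    f ∈ Submodule.span F (symMul a '' (goodIndex n h)ᶜ) := by
  suffices hmul : ∀ g, g * f ∈ Submodule.span F (symMul a '' (goodIndex n h)ᶜ) by
    simpa using hmul 1
  induction hf using Submodule.span_induction with
  | mem f hf =>
    intro g
    obtain ⟨k, r, S, hS, hrk, hr, rfl⟩ := hf
    have hkn : k ≤ n := by
      have := Finset.card_le_univ S
      rwa [hS, Fintype.card_fin] at this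
    rcases hkn.lt_or_eq with hlt | rfl
    · rw [dk_hook_of_lt hhn hμ hlt] at hr
      exact card_support_le_span ha ha' hh
        (mul_mem_card_support g (esymmS_mem_card_support (by omega) S))
    · have hSu : S = Finset.univ := by
        rw [← Finset.card_eq_iff_eq_univ, hS, Fintype.card_fin]
      subst hSu
      obtain ⟨m, rfl⟩ : ∃ m, r = m + 1 := ⟨r - 1, by omega⟩
      have hg : g ∈ Submodule.span F (symMul a '' Set.univ) := by
        rw [span_symMul_eq_top ha]; exact Submodule.mem_top
      induction hg using Submodule.span_induction with
      | mem g hg =>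
        obtain ⟨⟨w, c⟩, -, rfl⟩ := hg
        rw [mul_comm, esymmS_mul_symMul a w c ⟨m, by omega⟩]
        refine Submodule.subset_span ⟨_, fun hgood => ?_, rfl⟩
        have := congrFun hgood.2 ⟨m, by omega⟩
        simp at this
      | zero => rw [zero_mul]; exact Submodule.zero_mem _
      | add x y _ _ hx hy => rw [add_mul]; exact Submodule.add_mem _ hx hy
      | smul t x _ hx => rw [smul_mul_assoc]; exact Submodule.smul_mem _ t hx
  | zero => intro g; rw [mul_zero]; exact Submodule.zero_mem _
  | add x y _ _ hx hy => intro g; rw [mul_add]; exact Submodule.add_mem _ (hx g) (hy g)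
  | smul t x _ hx => intro g; rw [smul_eq_mul, ← mul_assoc]; exact hx _

theorem symMul_zero (w : Equiv.Perm (Fin n)) : symMul a (w, 0) = a w := by
  simp [symMul]

end Tanisaki

/-- **Basis assertion in the proof of Theorem 8.2.**  For the hook `μ = (1^{h-1}, n-h+1)`
with `h` parts, the images of the Demazure atoms `π̄_w(x_{D(w)})` for `w ∈ 𝔖_n` with
`D(w) ⊆ {1, …, h-1}` form an `F`-basis of `R_μ = F[x]/I_μ`.  (Here
`a w = π̄_{i_1} ∘ ⋯ ∘ π̄_{i_k}(x_{D(w)})` for a reduced word `w = s_{i_1} ⋯ s_{i_k}`, with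
`π_i` characterized by `(x_i - x_{i+1}) π_i f = x_i f - x_{i+1} s_i(f)`, `π̄_i = π_i - 1`.) -/
theorem stmt_18 (n : ℕ) (hn : 1 ≤ n) (F : Type*) [Field F] (h : ℕ)
    (hh : 1 ≤ h) (hhn : h ≤ n) (μ : n.Partition)
    (hμ : μ.parts = (n - h + 1) ::ₘ Multiset.replicate (h - 1) 1)
    (dem : ℕ → MvPolynomial (Fin n) F → MvPolynomial (Fin n) F)
    (hdem : ∀ (i : ℕ) (hi : i + 1 < n) (f : MvPolynomial (Fin n) F),
      (X (⟨i, Nat.lt_of_succ_lt hi⟩ : Fin n) - X ⟨i + 1, hi⟩) * dem i f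
        = X (⟨i, Nat.lt_of_succ_lt hi⟩ : Fin n) * f - X ⟨i + 1, hi⟩ * rename (sw n i) f)
    (a : Equiv.Perm (Fin n) → MvPolynomial (Fin n) F)
    (ha : ∀ w : Equiv.Perm (Fin n), ∃ l : List ℕ,
      (∀ i ∈ l, i + 1 < n) ∧ (l.map (sw n)).prod = w ∧ l.length = invNum w ∧
      a w = l.foldr (fun i f => dem i f - f) (xI F n (permDes w))) :
    LinearIndependent F
      (fun w : {w : Equiv.Perm (Fin n) // permDes w ⊆ Finset.range (h - 1)} =>
        Ideal.Quotient.mk (tanisaki n F μ) (a w.val)) ∧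
    Submodule.span F
      (Set.range fun w : {w : Equiv.Perm (Fin n) // permDes w ⊆ Finset.range (h - 1)} =>
        Ideal.Quotient.mk (tanisaki n F μ) (a w.val)) = ⊤ := by
  have hD : ∀ (i : ℕ) (hi : i + 1 < n),
      ∃ δ : MvPolynomial (Fin n) F →ₗ[F] MvPolynomial (Fin n) F,
        IsAtomOp ⟨i, Nat.lt_of_succ_lt hi⟩ ⟨i + 1, hi⟩ δ ∧ ∀ f, δ f = dem i f - f := by
    intro i hi
    have := hdem i hi
    rw [sw_of_lt hi] at this
    exact exists_isAtomOp (by simp) this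
  have hlead : ∀ w, IsLexLead (a w) ((desExp w).mapDomain w) := by
    intro w
    obtain ⟨l, hl, rfl, hlen, haw⟩ := ha w
    rw [haw, xI_eq_monomial]
    have hanti : Antitone (desExp (l.map (sw n)).prod) := fun i j hij =>
      expI_antitone (permDes (l.map (sw n)).prod) hij
    refine isLexLead_foldr hD hanti l hl hlen fun p q hpq hqp heq => ?_
    exact lt_asymm hqp (lt_of_no_descent hpq (not_mem_of_expI_eq hpq.le heq))
  have hsupp : ∀ w, ¬ permDes w ⊆ Finset.range (h - 1) →
      a w ∈ restrictSupport F {e : Fin n →₀ ℕ | h ≤ e.support.card} := by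
    intro w hw
    obtain ⟨l, hl, -, -, haw⟩ := ha w
    rw [haw]
    refine foldr_mem_card_support hD ?_ l hl
    obtain ⟨m, hm, hmh⟩ := Finset.not_subset.mp hw
    rw [Finset.mem_range, not_lt] at hmh
    have hmn := lt_of_mem_permDes hm
    rw [xI_eq_monomial, monomial_mem_restrictSupport]
    left
    have hsub : Finset.Iic (⟨m, by omega⟩ : Fin n) ⊆ (desExp w).support := by
      intro j hj
      rw [Finset.mem_Iic, Fin.le_def] at hj
      rw [Finsupp.mem_support_iff]
      exact Finset.card_ne_zero_of_mem (Finset.mem_filter.mpr ⟨hm, hj⟩)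
    have hcard := Finset.card_le_card hsub
    rw [Fin.card_Iic] at hcard
    simp only at hcard
    rw [Set.mem_ofPred_eq]
    omega
  let q : MvPolynomial (Fin n) F →ₗ[F] MvPolynomial (Fin n) F ⧸ tanisaki n F μ :=
    (Ideal.Quotient.mkₐ F (tanisaki n F μ)).toLinearMap
  have hq : ∀ f, q f = 0 ↔ f ∈ tanisaki n F μ := fun f => Ideal.Quotient.eq_zero_iff_mem
  have hli : LinearIndependent F (symMul a) :=
    linearIndependent_of_isRefLead leadExp_injective (isRefLead_symMul hlead)
  constructor
  · let emb : {w : Equiv.Perm (Fin n) // permDes w ⊆ Finset.range (h - 1)} →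
        Equiv.Perm (Fin n) × (Fin n → ℕ) := fun w => (w.val, 0)
    have hemb : Function.Injective emb := fun v w hvw => Subtype.ext (Prod.ext_iff.mp hvw).1
    have hres := (hli.comp emb hemb).map (f := q) (by
      refine (hli.disjoint_span_image (disjoint_compl_right (a := goodIndex n h))).mono ?_ ?_
      · refine Submodule.span_mono ?_
        rintro _ ⟨w, rfl⟩
        exact ⟨emb w, ⟨w.property, rfl⟩, rfl⟩
      · intro f hf
        exact tanisaki_le_span hlead hsupp hh hhn hμ ((hq f).mp hf))
    have hfun : (fun w : {w : Equiv.Perm (Fin n) // permDes w ⊆ Finset.range (h - 1)} =>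
        Ideal.Quotient.mk (tanisaki n F μ) (a w.val)) = q ∘ symMul a ∘ emb := by
      funext w
      simp only [Function.comp_apply, emb, symMul_zero]
      rfl
    rw [hfun]
    exact hres
  · have htop : Submodule.map q (Submodule.span F (symMul a '' Set.univ)) = ⊤ := by
      rw [span_symMul_eq_top hlead, Submodule.map_top, LinearMap.range_eq_top]
      exact Ideal.Quotient.mk_surjective
    rw [eq_top_iff, ← htop, Submodule.map_span, Submodule.span_le]
    rintro _ ⟨_, ⟨wc, -, rfl⟩, rfl⟩
    by_cases hwc : wc ∈ goodIndex n h
    · obtain ⟨w, c⟩ := wc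
      obtain ⟨hw, rfl⟩ : permDes w ⊆ Finset.range (h - 1) ∧ c = 0 := hwc
      rw [symMul_zero]
      exact Submodule.subset_span ⟨⟨w, hw⟩, rfl⟩
    · rw [(hq _).mpr (symMul_mem_tanisaki hsupp hh hhn hμ hwc)]
      exact Submodule.zero_mem _
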